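/- Let h be a Brouwer homeomorphism, D a free closed topological disk, and let lim⁺D, lim⁻D be the intersections with ℝ² of the Hausdorff limits of (h^n(D))_{n≥0} and (h^n(D))_{n≤0} respectively (taken in ℝ² ∪ {∞}). Then the three sets D, lim⁺D, lim⁻D are pairwise disjoint. -/

import Mathlib

open Set Filter Topology

/-- The plane. -/
abbrev Plane : Type := ℝ × ℝ

/-- A homeomorphism of the plane preserves orientation iff it is isotopic to the identity. -/
def IsotopicToId (h : Plane ≃ₜ Plane) : Prop :=
  ∃ H : ℝ → Plane ≃ₜ Plane,
    Continuous (fun p : ℝ × Plane => H p.1 p.2) ∧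
    H 0 = Homeomorph.refl Plane ∧ H 1 = h

/-- A Brouwer homeomorphism: an orientation-preserving (i.e. isotopic to the identity),
fixed-point-free homeomorphism of the plane. -/
structure BrouwerHomeo where
  toHomeomorph : Plane ≃ₜ Plane
  orientationPreserving : IsotopicToId toHomeomorph
  fixedPointFree : ∀ x : Plane, toHomeomorph x ≠ x

/-- The integer iterate `h^n`. -/
def BrouwerHomeo.iter (h : BrouwerHomeo) (n : ℤ) : Plane → Plane :=
  ⇑(h.toHomeomorph.toEquiv ^ n)

/-- A set is free if it is disjoint from its image under `h`. -/
def IsFree (h : BrouwerHomeo) (E : Set Plane) : Prop :=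
  Disjoint (h.toHomeomorph '' E) E

/-- A closed topological disk: a subset of the plane homeomorphic to the closed unit disk. -/
def IsClosedDisk (D : Set Plane) : Prop :=
  Nonempty (D ≃ₜ (Metric.closedBall (0 : Plane) 1 : Set Plane))

/-- Convergence of a sequence of compact subsets of the sphere `ℝ² ∪ {∞}` to a set `L`,
in the Hausdorff sense (on the space of nonempty compact subsets of a compact metrizable
space this is exactly convergence for the Hausdorff metric): eventually the terms are
contained in any open set containing `L`, and eventually meet any open set meeting `L`. -/
def HausdorffConvergesTo (A : ℕ → Set (OnePoint Plane)) (L : Set (OnePoint Plane)) : Prop :=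
  (∀ U : Set (OnePoint Plane), IsOpen U → L ⊆ U → ∀ᶠ n in Filter.atTop, A n ⊆ U) ∧
  (∀ U : Set (OnePoint Plane), IsOpen U → (L ∩ U).Nonempty →
    ∀ᶠ n in Filter.atTop, (A n ∩ U).Nonempty)

/-- An orientation-preserving plane homeomorphism without fixed points. -/
def IsBrouwer (h : Plane ≃ₜ Plane) : Prop :=
  IsotopicToId h ∧ ∀ x, h x ≠ x

theorem IsotopicToId.trans {g h : Plane ≃ₜ Plane} (hg : IsotopicToId g) (hh : IsotopicToId h) :
    IsotopicToId (g.trans h) := by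
  obtain ⟨G, hGc, hG0, hG1⟩ := hg
  obtain ⟨H, hHc, hH0, hH1⟩ := hh
  refine ⟨fun t => (G t).trans (H t), ?_, ?_, ?_⟩
  · exact hHc.comp (continuous_fst.prodMk hGc)
  · simp only [hG0, hH0]; rfl
  · simp only [hG1, hH1]

theorem isotopicToId_refl : IsotopicToId (Homeomorph.refl Plane) :=
  ⟨fun _ => Homeomorph.refl Plane, continuous_snd, rfl, rfl⟩

theorem IsotopicToId.conj {g : Plane ≃ₜ Plane} (hg : IsotopicToId g) (h : Plane ≃ₜ Plane) :
    IsotopicToId ((h.symm.trans g).trans h) := by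
  obtain ⟨G, hGc, hG0, hG1⟩ := hg
  refine ⟨fun t => (h.symm.trans (G t)).trans h, ?_, ?_, ?_⟩
  · exact h.continuous.comp
      (hGc.comp (continuous_fst.prodMk (h.symm.continuous.comp continuous_snd)))
  · ext1 x; simp [hG0]
  · simp only [hG1]

theorem exists_continuous_log {X : Type*} [TopologicalSpace X] [SimplyConnectedSpace X]
    [LocallyPathConnectedSpace X] {W : X → ℂ} (hW : Continuous W) (h0 : ∀ p, W p ≠ 0) :
    ∃ L : X → ℂ, Continuous L ∧ ∀ p, Complex.exp (L p) = W p := by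
  obtain ⟨p₀⟩ : Nonempty X := inferInstance
  obtain ⟨F, ⟨-, hF⟩, -⟩ := Complex.isCoveringMap_exp.existsUnique_continuousMap_lifts
    (⟨fun p => ⟨W p, h0 p⟩, by fun_prop⟩ : C(X, {z : ℂ // z ≠ 0})) p₀ (Complex.log (W p₀))
    (Subtype.ext (Complex.exp_log (h0 p₀)))
  exact ⟨F, F.continuous, fun p => congrArg Subtype.val (congrFun hF p)⟩

theorem eq_of_exp_comp_eq {X : Type*} [TopologicalSpace X] [PreconnectedSpace X] {F : X → ℂ}
    (hF : Continuous F) (h : ∀ a b, Complex.exp (F a) = Complex.exp (F b)) (a b : X) :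
    F a = F b :=
  Complex.isCoveringMap_exp.const_of_comp hF (fun a b => Subtype.ext (h a b)) a b

/-- A Brouwer homeomorphism has no point of period two. -/
theorem IsBrouwer.apply_apply_ne {h : Plane ≃ₜ Plane} (hh : IsBrouwer h) (x : Plane) :
    h (h x) ≠ x := by
  intro hx
  obtain ⟨⟨H, hHc, hH0, hH1⟩, hfix⟩ := hh
  let e : Plane → ℂ := fun p => Complex.equivRealProdCLM.symm p
  have he : Continuous e := Complex.equivRealProdCLM.symm.continuous
  have einj : ∀ a b, e a = e b → a = b := fun a b hab =>
    Complex.equivRealProdCLM.symm.injective hab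
  let W : Plane × ℝ → ℂ := fun p => e (H p.2 (h p.1)) - e (H p.2 p.1)
  have hWc : Continuous W := by
    have h1 : Continuous fun p : Plane × ℝ => H p.2 (h p.1) :=
      hHc.comp (continuous_snd.prodMk (h.continuous.comp continuous_fst))
    have h2 : Continuous fun p : Plane × ℝ => H p.2 p.1 :=
      hHc.comp (continuous_snd.prodMk continuous_fst)
    exact (he.comp h1).sub (he.comp h2)
  have hW0 : ∀ p, W p ≠ 0 := fun p hp =>
    hfix p.1 ((H p.2).injective (einj _ _ (sub_eq_zero.mp hp)))
  obtain ⟨L, hLc, hL⟩ := exists_continuous_log hWc hW0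
  have hend : ∀ z, Complex.exp (L (z, 1)) = Complex.exp (L (h z, 0)) := by
    intro z
    rw [hL, hL]
    simp [W, hH0, hH1]
  have hconst := eq_of_exp_comp_eq (F := fun z : Plane => L (z, 1) - L (h z, 0))
    (by have := h.continuous; fun_prop)
    (fun a b => by
      rw [Complex.exp_sub, Complex.exp_sub, hend, hend, div_self (Complex.exp_ne_zero _),
        div_self (Complex.exp_ne_zero _)]) x (h x)
  have hneg : ∀ t, Complex.exp (L (h x, t)) = -Complex.exp (L (x, t)) := by
    intro t
    rw [hL, hL]
    simp [W, hx]
  have hconst' := eq_of_exp_comp_eq (F := fun t : ℝ => L (h x, t) - L (x, t)) (by fun_prop)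
    (fun a b => by
      rw [Complex.exp_sub, Complex.exp_sub, hneg, hneg, neg_div, neg_div,
        div_self (Complex.exp_ne_zero _), div_self (Complex.exp_ne_zero _)]) 0 1
  simp only [hx] at hconst hconst'
  have key : L (h x, 0) = L (x, 0) := by linear_combination (hconst' - hconst) / 2
  have := hneg 0
  rw [key] at this
  exact Complex.exp_ne_zero (L (x, 0)) (by linear_combination this / 2)

/-- A map isotopic to the identity, supported in `V`, moves `a` to `b`. -/
def Pushes (V : Set Plane) (a b : Plane) : Prop :=
  ∃ φ : Plane ≃ₜ Plane, IsotopicToId φ ∧ (∀ y, y ∉ V → φ y = y) ∧ φ a = b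

theorem Pushes.refl (V : Set Plane) (a : Plane) : Pushes V a a :=
  ⟨Homeomorph.refl Plane, isotopicToId_refl, fun _ _ => rfl, rfl⟩

theorem Pushes.trans {V : Set Plane} {a b c : Plane} (hab : Pushes V a b) (hbc : Pushes V b c) :
    Pushes V a c := by
  obtain ⟨φ, hφ, hφV, rfl⟩ := hab
  obtain ⟨ψ, hψ, hψV, rfl⟩ := hbc
  refine ⟨φ.trans ψ, hφ.trans hψ, fun y hy => ?_, rfl⟩
  simp [hφV y hy, hψV y hy]

theorem pushes_of_mem_ball {V : Set Plane} {a b : Plane} {δ : ℝ} (hV : Metric.ball a δ ⊆ V)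
    (hb : b ∈ Metric.ball a δ) : Pushes V a b := by
  have hδ : 0 < δ := Metric.pos_of_mem_ball hb
  let s : ℝ → ℝ := fun t => max 0 (min t 1)
  have hs : Continuous s := by fun_prop
  have hs0 : ∀ t, 0 ≤ s t := fun t => le_max_left _ _
  have hs1 : ∀ t, s t ≤ 1 := fun t => max_le zero_le_one (min_le_right _ _)
  let χ : Plane → ℝ := fun y => max 0 (1 - dist y a / δ)
  have hχ : ∀ y z, |χ y - χ z| ≤ dist y z / δ := by
    intro y z
    calc |χ y - χ z| ≤ |(1 - dist y a / δ) - (1 - dist z a / δ)| := by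
          have := abs_max_sub_max_le_max (0 : ℝ) (1 - dist y a / δ) 0 (1 - dist z a / δ)
          simpa [χ] using this
      _ = |dist y a - dist z a| / δ := by
          rw [show (1 - dist y a / δ) - (1 - dist z a / δ) = -((dist y a - dist z a) / δ) by ring,
            abs_neg, abs_div, abs_of_pos hδ]
      _ ≤ dist y z / δ := by
          gcongr
          exact abs_dist_sub_le y z a
  let f : ℝ → Plane → Plane := fun t y => y + (s t * χ y) • (b - a)
  have hb' : ‖b - a‖ < δ := by rwa [← dist_eq_norm]
  let c : NNReal := ⟨‖b - a‖ / δ, by positivity⟩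
  have hc1 : c < 1 := by
    rw [← NNReal.coe_lt_coe]
    exact (div_lt_one hδ).2 hb'
  have happ : ∀ t, ApproximatesLinearOn (f t)
      ((ContinuousLinearEquiv.refl ℝ Plane : Plane ≃L[ℝ] Plane) : Plane →L[ℝ] Plane) univ c := by
    intro t y _ z _
    have e1 : f t y - f t z - ((ContinuousLinearEquiv.refl ℝ Plane : Plane ≃L[ℝ] Plane) :
        Plane →L[ℝ] Plane) (y - z) = (s t * (χ y - χ z)) • (b - a) := by
      simp only [f, ContinuousLinearEquiv.coe_refl, ContinuousLinearMap.id_apply, mul_sub, sub_smul]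
      abel
    rw [e1, norm_smul, Real.norm_eq_abs, abs_mul, abs_of_nonneg (hs0 t)]
    calc s t * |χ y - χ z| * ‖b - a‖ ≤ 1 * (dist y z / δ) * ‖b - a‖ := by
          gcongr
          · exact hs1 t
          · exact hχ y z
      _ = (‖b - a‖ / δ) * ‖y - z‖ := by rw [dist_eq_norm]; ring
      _ = c * ‖y - z‖ := rfl
  have hcN : c < ‖(((ContinuousLinearEquiv.refl ℝ Plane).symm : Plane ≃L[ℝ] Plane) :
      Plane →L[ℝ] Plane)‖₊⁻¹ := by
    rw [ContinuousLinearEquiv.refl_symm, ContinuousLinearEquiv.coe_refl,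
      ContinuousLinearMap.nnnorm_id, inv_one]
    exact hc1
  let Φ : ℝ → Plane ≃ₜ Plane := fun t => (happ t).toHomeomorph (f t) (Or.inr hcN)
  have hΦ : ∀ t y, Φ t y = f t y := fun t y => rfl
  refine ⟨Φ 1, ⟨Φ, ?_, ?_, rfl⟩, ?_, ?_⟩
  · simp only [hΦ, f, χ]
    fun_prop
  · ext1 y
    simp [hΦ, f, s]
  · intro y hy
    have : 1 - dist y a / δ ≤ 0 := by
      have : δ ≤ dist y a := by
        by_contra! hlt
        exact hy (hV hlt)
      rw [sub_nonpos]
      exact (one_le_div hδ).2 this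
    simp [hΦ, f, χ, max_eq_left this]
  · simp [hΦ, f, χ, s]

/-- An open connected subset of the plane is homogeneous under isotopies it supports. -/
theorem IsPreconnected.pushes {V : Set Plane} (hVo : IsOpen V) (hVc : IsPreconnected V)
    {a b : Plane} (ha : a ∈ V) (hb : b ∈ V) : Pushes V a b := by
  let S : Set Plane := {y | y ∈ V ∧ Pushes V a y}
  have hSo : IsOpen S := by
    rw [Metric.isOpen_iff]
    rintro y ⟨hyV, hy⟩
    obtain ⟨δ, hδ, hsub⟩ := Metric.isOpen_iff.1 hVo y hyV
    exact ⟨δ, hδ, fun z hz => ⟨hsub hz, hy.trans (pushes_of_mem_ball hsub hz)⟩⟩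
  have hsub : V ⊆ S := by
    refine hVc.subset_of_closure_inter_subset hSo ⟨a, ha, ha, Pushes.refl V a⟩ ?_
    rintro z ⟨hz, hzV⟩
    obtain ⟨δ, hδ, hsub⟩ := Metric.isOpen_iff.1 hVo z hzV
    obtain ⟨y, hy, hzy⟩ := Metric.mem_closure_iff.1 hz (δ / 2) (half_pos hδ)
    refine ⟨hzV, hy.2.trans (pushes_of_mem_ball (δ := δ / 2) (fun w hw => hsub ?_) hzy)⟩
    rw [Metric.mem_ball] at hw ⊢
    rw [dist_comm] at hzy
    linarith [dist_triangle w y z]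
  exact (hsub hb).2

/-- Composing with a homeomorphism supported in a free set creates no fixed point. -/
theorem IsBrouwer.trans {h φ : Plane ≃ₜ Plane} (hh : IsBrouwer h) (hφ : IsotopicToId φ)
    {V : Set Plane} (hφV : ∀ y, y ∉ V → φ y = y) (hV : ∀ z ∈ V, h z ∉ V) :
    IsBrouwer (h.trans φ) := by
  refine ⟨hh.1.trans hφ, fun z hz => ?_⟩
  change φ (h z) = z at hz
  by_cases hzV : h z ∈ V
  · have hz' : φ z = z := hφV z fun h' => hV z h' hzV
    exact hh.2 z (φ.injective (hz.trans hz'.symm))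
  · exact hh.2 z ((hφV _ hzV).symm.trans hz)

theorem iterate_eq_iterate_of_orbit {α : Type*} {g h : α → α} {x : α} :
    ∀ {k : ℕ}, (∀ i < k, g (h^[i] x) = h^[i + 1] x) → g^[k] x = h^[k] x
  | 0, _ => rfl
  | k + 1, H => by
    rw [Function.iterate_succ_apply',
      iterate_eq_iterate_of_orbit fun i hi => H i (hi.trans k.lt_succ_self), H k k.lt_succ_self]

/-- If Brouwer homeomorphisms have no periodic points of period up to `N`, then free open connected
sets do not return to themselves in time up to `N`. -/
theorem iterate_notMem_of_free_of_le {N : ℕ}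
    (hN : ∀ g : Plane ≃ₜ Plane, IsBrouwer g → ∀ k, 1 ≤ k → k ≤ N → ∀ x, g^[k] x ≠ x)
    {h : Plane ≃ₜ Plane} (hh : IsBrouwer h) {V : Set Plane} (hVo : IsOpen V)
    (hVc : IsPreconnected V) (hV : ∀ z ∈ V, h z ∉ V) {x : Plane} (hx : x ∈ V) (k : ℕ)
    (hk1 : 1 ≤ k) (hkN : k ≤ N) : h^[k] x ∉ V := by
  induction k using Nat.strong_induction_on with
  | _ k ih =>
    intro hk
    obtain ⟨φ, hφ, hφV, hφx⟩ := hVc.pushes hVo hk hx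
    obtain ⟨j, rfl⟩ : ∃ j, k = j + 1 := ⟨k - 1, by omega⟩
    refine hN _ (hh.trans hφ hφV hV) (j + 1) hk1 hkN x ?_
    have horb : (h.trans φ)^[j] x = h^[j] x := by
      refine iterate_eq_iterate_of_orbit fun i hi => ?_
      rw [Function.iterate_succ_apply' h]
      refine hφV (h (h^[i] x)) ?_
      rw [← Function.iterate_succ_apply' h]
      exact ih (i + 1) (by omega) (by omega) (by omega)
    rw [Function.iterate_succ_apply', horb]
    change φ (h (h^[j] x)) = x
    rw [← Function.iterate_succ_apply' h, hφx]

theorem IsOpenMap.iterate {X : Type*} [TopologicalSpace X] {f : X → X} (hf : IsOpenMap f) :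
    ∀ k : ℕ, IsOpenMap f^[k]
  | 0 => IsOpenMap.id
  | k + 1 => (IsOpenMap.iterate hf k).comp hf

/-- A compact free set has an open neighborhood which is free. -/
theorem exists_isOpen_free {h : Plane ≃ₜ Plane} {K : Set Plane} (hK : IsCompact K)
    (hfree : ∀ z ∈ K, h z ∉ K) : ∃ O, IsOpen O ∧ K ⊆ O ∧ ∀ z ∈ O, h z ∉ O := by
  have hdisj : Disjoint K (h '' K) := by
    rw [Set.disjoint_left]
    rintro _ hz ⟨w, hw, rfl⟩
    exact hfree w hw hz
  obtain ⟨A, B, hA, hB, hKA, hKB, hAB⟩ :=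
    SeparatedNhds.of_isCompact_isCompact hK (hK.image h.continuous) hdisj
  refine ⟨A ∩ h ⁻¹' B, hA.inter (hB.preimage h.continuous),
    fun z hz => ⟨hKA hz, hKB (mem_image_of_mem h hz)⟩, fun z hz hz' => ?_⟩
  exact Set.disjoint_left.1 hAB hz'.1 hz.2

/-- A compact connected free set has a free connected open neighborhood, as small as desired. -/
theorem exists_isOpen_isPreconnected_free {h : Plane ≃ₜ Plane} {K O : Set Plane}
    (hK : IsCompact K) (hKc : IsPreconnected K) (hfree : ∀ z ∈ K, h z ∉ K) (hO : IsOpen O)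
    (hKO : K ⊆ O) :
    ∃ V, IsOpen V ∧ IsPreconnected V ∧ K ⊆ V ∧ V ⊆ O ∧ ∀ z ∈ V, h z ∉ V := by
  rcases K.eq_empty_or_nonempty with rfl | ⟨x, hx⟩
  · exact ⟨∅, isOpen_empty, isPreconnected_empty, Subset.rfl, empty_subset _, by simp⟩
  obtain ⟨A, hA, hKA, hAfree⟩ := exists_isOpen_free hK hfree
  have hsub := connectedComponentIn_subset (A ∩ O) x
  exact ⟨connectedComponentIn (A ∩ O) x, (hA.inter hO).connectedComponentIn,
    isPreconnected_connectedComponentIn,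
    hKc.subset_connectedComponentIn hx (subset_inter hKA hKO), fun z hz => (hsub hz).2,
    fun z hz hz' => hAfree z (hsub hz).1 (hsub hz').1⟩

/-- Around every point there is a maximal free open ball; it comes with a point of its closure
whose image is also in the closure. -/
theorem exists_maximal_free_ball {h : Plane ≃ₜ Plane} (hfix : ∀ x, h x ≠ x) (x : Plane) :
    ∃ (r : ℝ) (z : Plane), 0 < r ∧ z ∈ Metric.closedBall x r ∧ h z ∈ Metric.closedBall x r ∧
      ∀ y ∈ Metric.ball x r, h y ∉ Metric.ball x r := by
  let m : Plane → ℝ := fun y => max (dist y x) (dist (h y) x)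
  have hm : Continuous m := by
    have := h.continuous
    fun_prop
  obtain ⟨z, hz⟩ := hm.exists_forall_le
    (tendsto_atTop_mono (fun y => le_max_left _ _) (tendsto_dist_right_cocompact_atTop x))
  refine ⟨m z, z, ?_, le_max_left (dist z x) _, le_max_right _ (dist (h z) x), fun y hy hy' => ?_⟩
  · by_contra! hle
    have h1 : z = x := dist_le_zero.1 ((le_max_left _ _).trans hle)
    have h2 : h z = x := dist_le_zero.1 ((le_max_right _ _).trans hle)
    exact hfix z (h2.trans h1.symm)
  · exact (max_lt (Metric.mem_ball.1 hy) (Metric.mem_ball.1 hy')).not_ge (hz y)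

theorem mem_ball_or_eq_of_mem_segment {x y z : Plane} {r : ℝ} (hr : 0 < r)
    (hz : z ∈ Metric.closedBall x r) (hy : y ∈ segment ℝ x z) : y ∈ Metric.ball x r ∨ y = z := by
  obtain ⟨t, ⟨ht0, ht1⟩, rfl⟩ := (segment_eq_image_lineMap ℝ x z).subset hy
  rcases ht1.lt_or_eq with ht | rfl
  · left
    rw [Metric.mem_ball, dist_lineMap_left, Real.norm_of_nonneg ht0, dist_comm]
    rw [Metric.mem_closedBall] at hz
    nlinarith
  · right
    simp

theorem isCompact_segment (x z : Plane) : IsCompact (segment ℝ x z) := by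
  rw [segment_eq_image_lineMap]
  exact isCompact_Icc.image AffineMap.lineMap_continuous

/-- A periodic point of period at least three of a Brouwer homeomorphism can be short-cut. -/
theorem IsBrouwer.exists_shorter_period {n : ℕ} (hn : 2 ≤ n)
    (hP : ∀ g : Plane ≃ₜ Plane, IsBrouwer g → ∀ k, 1 ≤ k → k ≤ n → ∀ x, g^[k] x ≠ x)
    {h : Plane ≃ₜ Plane} (hh : IsBrouwer h) {x : Plane} (hx : h^[n + 1] x = x) :
    ∃ g : Plane ≃ₜ Plane, IsBrouwer g ∧ g^[n] (h x) = h x := by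
  obtain ⟨r, z, hr, hz, hhz, hball⟩ := exists_maximal_free_ball hh.2 x
  have hxB : x ∈ Metric.ball x r := Metric.mem_ball_self hr
  have hcl : closure (Metric.ball x r) = Metric.closedBall x r := closure_ball x hr.ne'
  have hret : ∀ k, 1 ≤ k → k ≤ n → ∀ y ∈ Metric.closedBall x r, h^[k] y ∉ Metric.ball x r := by
    intro k hk1 hkn y hy hmem
    have hO : IsOpen (h^[k] ⁻¹' Metric.ball x r) :=
      Metric.isOpen_ball.preimage (h.continuous.iterate k)
    rw [← hcl] at hy
    obtain ⟨w, hw, hwB⟩ := mem_closure_iff.1 hy _ hO hmem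
    exact iterate_notMem_of_free_of_le hP hh Metric.isOpen_ball
      (convex_ball x r).isPreconnected hball hwB k hk1 hkn hw
  have hret' : ∀ k, 1 ≤ k → k ≤ n → ∀ y ∈ Metric.ball x r, h^[k] y ∉ Metric.closedBall x r := by
    intro k hk1 hkn y hy hmem
    have hO : IsOpen (h^[k] '' Metric.ball x r) :=
      h.isOpenMap.iterate k _ Metric.isOpen_ball
    rw [← hcl] at hmem
    obtain ⟨_, ⟨w, hw, rfl⟩, hwB⟩ := mem_closure_iff.1 hmem _ hO (mem_image_of_mem _ hy)
    exact hret k hk1 hkn w (Metric.ball_subset_closedBall hw) hwB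
  have hsegz : ∀ w ∈ segment ℝ x z, h w ∉ segment ℝ x z := by
    intro w hw hw'
    rcases mem_ball_or_eq_of_mem_segment hr hz hw' with h1 | h1
    · exact hret 1 le_rfl (by omega) w
        ((convex_closedBall x r).segment_subset (Metric.ball_subset_closedBall hxB) hz hw) h1
    · rcases mem_ball_or_eq_of_mem_segment hr hz hw with h2 | rfl
      · exact hret' 1 le_rfl (by omega) w h2 (by simpa [h1] using hz)
      · exact hh.2 _ h1
  obtain ⟨A, hA, hKA, hAfree⟩ := exists_isOpen_free (isCompact_segment x z) hsegz
  have hdisj : Disjoint (h^[2] '' segment ℝ x z) (segment ℝ x (h z)) := by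
    rw [Set.disjoint_left]
    rintro _ ⟨w, hw, rfl⟩ hw'
    have hwB := (convex_closedBall x r).segment_subset (Metric.ball_subset_closedBall hxB) hz hw
    have hwB' := (convex_closedBall x r).segment_subset (Metric.ball_subset_closedBall hxB) hhz hw'
    rcases mem_ball_or_eq_of_mem_segment hr hz hw with h1 | rfl
    · exact hret' 2 (by omega) hn w h1 hwB'
    · rcases mem_ball_or_eq_of_mem_segment hr hhz hw' with h2 | h2
      · exact hret 2 (by omega) hn _ hwB h2
      · exact hh.2 _ h2
  obtain ⟨C, N, hC, hN, hKC, hKN, hCN⟩ := SeparatedNhds.of_isCompact_isCompact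
    ((isCompact_segment x z).image (h.continuous.iterate 2)) (isCompact_segment x (h z)) hdisj
  obtain ⟨δ, hδ, hδN⟩ := (isCompact_segment x (h z)).exists_thickening_subset_open hN hKN
  obtain ⟨ε, hε, hεV⟩ := (isCompact_segment x z).exists_thickening_subset_open
    (hA.inter (hC.preimage (h.continuous.iterate 2)))
    (fun w hw => ⟨hKA hw, hKC (mem_image_of_mem _ hw)⟩)
  set T := Metric.thickening δ (segment ℝ x (h z)) with hT
  set V := Metric.thickening ε (segment ℝ x z) with hV
  have hVo : IsOpen V := Metric.isOpen_thickening
  have hVc : IsPreconnected V := ((convex_segment x z).thickening ε).isPreconnected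
  have hVfree : ∀ w ∈ V, h w ∉ V := fun w hw hw' => hAfree w (hεV hw).1 (hεV hw').1
  have hxV : x ∈ V := Metric.self_subset_thickening hε _ (left_mem_segment ℝ x z)
  have hzV : z ∈ V := Metric.self_subset_thickening hε _ (right_mem_segment ℝ x z)
  have hhVo : IsOpen (h '' V) := h.isOpenMap V hVo
  have hhVc : IsPreconnected (h '' V) := hVc.image h h.continuous.continuousOn
  obtain ⟨u, ⟨huV, huT⟩, huB⟩ : ((h '' V ∩ T) ∩ Metric.ball x r).Nonempty := by
    rw [← hcl] at hhz
    exact mem_closure_iff.1 hhz _ (hhVo.inter Metric.isOpen_thickening)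
      ⟨mem_image_of_mem h hzV, Metric.self_subset_thickening hδ _ (right_mem_segment ℝ x (h z))⟩
  obtain ⟨φ, hφ, hφs, hφx⟩ := (((convex_ball x r).inter
    ((convex_segment x (h z)).thickening δ)).isPreconnected).pushes
      (Metric.isOpen_ball.inter Metric.isOpen_thickening)
      ⟨hxB, Metric.self_subset_thickening hδ _ (left_mem_segment ℝ x (h z))⟩ ⟨huB, huT⟩
  obtain ⟨ψ, hψ, hψs, hψu⟩ := hhVc.pushes hhVo huV (mem_image_of_mem h hxV)
  have hg₁ : IsBrouwer (h.trans φ) :=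
    hh.trans hφ hφs fun w hw hw' => hball w hw.1 hw'.1
  have hg₂ : IsBrouwer ((h.trans φ).trans ψ) := by
    refine hg₁.trans hψ hψs ?_
    rintro _ ⟨w, hw, rfl⟩ hmem
    have hfixed : φ (h (h w)) = h (h w) :=
      hφs _ fun hm => Set.disjoint_left.1 hCN (hεV hw).2 (hδN hm.2)
    rw [Homeomorph.trans_apply, hfixed] at hmem
    exact hVfree w hw ((h.injective.mem_set_image).1 hmem)
  refine ⟨_, hg₂, ?_⟩
  obtain ⟨k, rfl⟩ : ∃ k, n = k + 1 := ⟨n - 1, by omega⟩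
  have horb : ((h.trans φ).trans ψ)^[k] (h x) = h^[k] (h x) := by
    refine iterate_eq_iterate_of_orbit fun i hi => ?_
    have e1 : h (h^[i] (h x)) = h^[i + 2] x := by
      rw [Function.iterate_succ_apply', Function.iterate_succ_apply]
    have e2 : φ (h^[i + 2] x) = h^[i + 2] x := hφs _ fun hm =>
      hret (i + 2) (by omega) (by omega) x (Metric.ball_subset_closedBall hxB) hm.1
    have e3 : ψ (h^[i + 2] x) = h^[i + 2] x := by
      refine hψs _ fun hm => ?_
      rw [Function.iterate_succ_apply', h.injective.mem_set_image] at hm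
      exact iterate_notMem_of_free_of_le hP hh hVo hVc hVfree hxV (i + 1) (by omega) (by omega) hm
    change ψ (φ (h (h^[i] (h x)))) = h^[i + 1] (h x)
    rw [e1, e2, e3, ← Function.iterate_succ_apply]
  rw [Function.iterate_succ_apply', horb, ← Function.iterate_succ_apply]
  change ψ (φ (h (h^[k + 1] x))) = h x
  rw [← Function.iterate_succ_apply' h, hx, hφx, hψu]

/-- A Brouwer homeomorphism has no periodic point. -/
theorem IsBrouwer.iterate_ne {h : Plane ≃ₜ Plane} (hh : IsBrouwer h) (n : ℕ) (hn : 1 ≤ n)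
    (x : Plane) : h^[n] x ≠ x := by
  induction n using Nat.strong_induction_on generalizing h x with
  | _ n ih =>
    intro hx
    match n, hn with
    | 1, _ => exact hh.2 x hx
    | 2, _ => exact hh.apply_apply_ne x hx
    | m + 3, _ =>
      obtain ⟨g, hg, hgx⟩ := hh.exists_shorter_period (n := m + 2) (by omega)
        (fun g hg k hk1 hk x => ih k (by omega) hg hk1 x) hx
      exact ih (m + 2) (by omega) hg (by omega) _ hgx

/-- A free open connected set never returns to itself. -/
theorem IsBrouwer.iterate_notMem {h : Plane ≃ₜ Plane} (hh : IsBrouwer h) {V : Set Plane}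
    (hVo : IsOpen V) (hVc : IsPreconnected V) (hV : ∀ z ∈ V, h z ∉ V) {x : Plane} (hx : x ∈ V)
    {k : ℕ} (hk : 1 ≤ k) : h^[k] x ∉ V :=
  iterate_notMem_of_free_of_le (N := k) (fun _ hg j hj _ x => hg.iterate_ne j hj x) hh hVo hVc hV
    hx k hk le_rfl

/-- Two disjoint free open connected sets do not form a closed chain. -/
theorem IsBrouwer.no_two_chain {h : Plane ≃ₜ Plane} (hh : IsBrouwer h) {U V : Set Plane}
    (hUo : IsOpen U) (hUc : IsPreconnected U) (hU : ∀ z ∈ U, h z ∉ U)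
    (hVo : IsOpen V) (hVc : IsPreconnected V) (hV : ∀ z ∈ V, h z ∉ V) (hUV : Disjoint U V)
    {a b : Plane} (ha : a ∈ U) (hb : b ∈ V) {m n : ℕ} (hm : 1 ≤ m) (hn : 1 ≤ n)
    (ham : h^[m] a ∈ V) (hbn : h^[n] b ∈ U) : False := by
  obtain ⟨φ, hφ, hφU, hφb⟩ := hUc.pushes hUo hbn ha
  obtain ⟨ψ, hψ, hψV, hψa⟩ := hVc.pushes hVo ham hb
  have hφU' : ∀ y ∈ U, φ y ∈ U := fun y hy => by
    by_contra hmem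
    exact hmem ((φ.injective (hφU _ hmem)).symm ▸ hy)
  have hg₁ : IsBrouwer (h.trans φ) := hh.trans hφ hφU hU
  have hg : IsBrouwer ((h.trans φ).trans ψ) := by
    refine hg₁.trans hψ hψV fun y hy hmem => ?_
    change φ (h y) ∈ V at hmem
    by_cases hyU : h y ∈ U
    · exact Set.disjoint_left.1 hUV (hφU' _ hyU) hmem
    · rw [hφU _ hyU] at hmem
      exact hV y hy hmem
  have hfixed : ∀ y, y ∉ U → y ∉ V → ψ (φ y) = y := fun y h1 h2 => by rw [hφU y h1, hψV y h2]
  obtain ⟨m, rfl⟩ : ∃ j, m = j + 1 := ⟨m - 1, by omega⟩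
  obtain ⟨n, rfl⟩ : ∃ j, n = j + 1 := ⟨n - 1, by omega⟩
  have hleaveU : ∀ y ∈ U, ∀ k, 1 ≤ k → h^[k] y ∉ U := fun y hy k hk =>
    hh.iterate_notMem hUo hUc hU hy hk
  have hleaveV : ∀ y ∈ V, ∀ k, 1 ≤ k → h^[k] y ∉ V := fun y hy k hk =>
    hh.iterate_notMem hVo hVc hV hy hk
  have hsplit : ∀ (y : Plane) {i j : ℕ}, i < j → h^[j] y = h^[j - i] (h^[i] y) :=
    fun y i j hij => by rw [← Function.iterate_add_apply, Nat.sub_add_cancel hij.le]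
  have horba : ((h.trans φ).trans ψ)^[m + 1] a = b := by
    rw [Function.iterate_succ_apply', iterate_eq_iterate_of_orbit (h := h)]
    · change ψ (φ (h (h^[m] a))) = b
      rw [← Function.iterate_succ_apply' h, hφU _ (hleaveU a ha _ (by omega)), hψa]
    · intro i hi
      change ψ (φ (h (h^[i] a))) = _
      rw [← Function.iterate_succ_apply' h]
      refine hfixed _ (hleaveU a ha _ (by omega)) fun hmem => ?_
      refine hleaveV _ hmem (m + 1 - (i + 1)) (by omega) ?_
      rwa [← hsplit a (by omega)]
  have horbb : ((h.trans φ).trans ψ)^[n + 1] b = a := by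
    rw [Function.iterate_succ_apply', iterate_eq_iterate_of_orbit (h := h)]
    · change ψ (φ (h (h^[n] b))) = a
      rw [← Function.iterate_succ_apply' h, hφb, hψV _ (Set.disjoint_left.1 hUV ha)]
    · intro i hi
      change ψ (φ (h (h^[i] b))) = _
      rw [← Function.iterate_succ_apply' h]
      refine hfixed _ (fun hmem => ?_) (hleaveV b hb _ (by omega))
      refine hleaveU _ hmem (n + 1 - (i + 1)) (by omega) ?_
      rwa [← hsplit b (by omega)]
  refine hg.iterate_ne ((n + 1) + (m + 1)) (by omega) a ?_
  rw [Function.iterate_add_apply, horba, horbb]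

theorem IsClosedDisk.isCompact {D : Set Plane} (hD : IsClosedDisk D) : IsCompact D := by
  obtain ⟨e⟩ := hD
  have := isCompact_iff_compactSpace.1 (isCompact_closedBall (0 : Plane) 1)
  exact isCompact_iff_compactSpace.2 e.symm.compactSpace

theorem IsClosedDisk.isPreconnected {D : Set Plane} (hD : IsClosedDisk D) : IsPreconnected D := by
  obtain ⟨e⟩ := hD
  have := isPreconnected_iff_preconnectedSpace.1
    (convex_closedBall (0 : Plane) 1).isPreconnected
  rw [isPreconnected_iff_preconnectedSpace]
  exact ⟨e.symm.surjective.range_eq ▸ isPreconnected_range e.symm.continuous⟩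

theorem HausdorffConvergesTo.eventually_exists_mem {A : ℕ → Set Plane} {L : Set (OnePoint Plane)}
    (hL : HausdorffConvergesTo (fun n => OnePoint.some '' A n) L) {x : Plane}
    (hx : OnePoint.some x ∈ L) {U : Set Plane} (hU : IsOpen U) (hxU : x ∈ U) :
    ∀ᶠ n in atTop, ∃ y ∈ A n, y ∈ U := by
  filter_upwards [hL.2 (OnePoint.some '' U) (OnePoint.isOpen_image_coe.2 hU)
    ⟨_, hx, mem_image_of_mem _ hxU⟩] with n hn
  obtain ⟨_, ⟨y, hy, rfl⟩, ⟨w, hw, hwy⟩⟩ := hn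
  exact ⟨y, hy, OnePoint.coe_injective hwy ▸ hw⟩

theorem BrouwerHomeo.iter_natCast (h : BrouwerHomeo) (n : ℕ) (x : Plane) :
    h.iter n x = h.toHomeomorph^[n] x := by
  simp only [BrouwerHomeo.iter, zpow_natCast]
  exact (congrFun (Equiv.Perm.iterate_eq_pow h.toHomeomorph.toEquiv n) x).symm

theorem BrouwerHomeo.iterate_iter_neg (h : BrouwerHomeo) (n : ℕ) (x : Plane) :
    h.toHomeomorph^[n] (h.iter (-(n : ℤ)) x) = x := by
  rw [← h.iter_natCast]
  simp [BrouwerHomeo.iter]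

/-- Let `D` be a free closed topological disk, and let `L⁺`, `L⁻` be the
Hausdorff limits (in `ℝ² ∪ {∞}`) of the forward and backward iterates of `D`. Then the
three sets `D`, `lim⁺D = L⁺ ∩ ℝ²` and `lim⁻D = L⁻ ∩ ℝ²` are pairwise disjoint. -/
theorem limit_sets_pairwise_disjoint (h : BrouwerHomeo) (D : Set Plane)
    (hD : IsClosedDisk D) (hfree : IsFree h D)
    (Lp Lm : Set (OnePoint Plane))
    (hLp : HausdorffConvergesTo (fun n : ℕ => OnePoint.some '' (h.iter (n : ℤ) '' D)) Lp)
    (hLm : HausdorffConvergesTo (fun n : ℕ => OnePoint.some '' (h.iter (-(n : ℤ)) '' D)) Lm) :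
    Disjoint D {x : Plane | OnePoint.some x ∈ Lp} ∧
    Disjoint D {x : Plane | OnePoint.some x ∈ Lm} ∧
    Disjoint {x : Plane | OnePoint.some x ∈ Lp} {x : Plane | OnePoint.some x ∈ Lm} := by
  have hh : IsBrouwer h.toHomeomorph := ⟨h.orientationPreserving, h.fixedPointFree⟩
  have hDf : ∀ z ∈ D, h.toHomeomorph z ∉ D := fun z hz hz' =>
    Set.disjoint_left.1 hfree (mem_image_of_mem _ hz) hz'
  have hp : ∀ x, OnePoint.some x ∈ Lp → ∀ U, IsOpen U → x ∈ U →
      ∃ n, 1 ≤ n ∧ ∃ d ∈ D, h.toHomeomorph^[n] d ∈ U := by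
    intro x hx U hU hxU
    obtain ⟨n, ⟨_, ⟨d, hd, rfl⟩, hdU⟩, hn⟩ :=
      ((hLp.eventually_exists_mem hx hU hxU).and (eventually_ge_atTop 1)).exists
    exact ⟨n, hn, d, hd, h.iter_natCast n d ▸ hdU⟩
  have hm : ∀ x, OnePoint.some x ∈ Lm → ∀ U, IsOpen U → x ∈ U →
      ∃ n, 1 ≤ n ∧ ∃ y ∈ U, h.toHomeomorph^[n] y ∈ D := by
    intro x hx U hU hxU
    obtain ⟨n, ⟨_, ⟨d, hd, rfl⟩, hdU⟩, hn⟩ :=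
      ((hLm.eventually_exists_mem hx hU hxU).and (eventually_ge_atTop 1)).exists
    exact ⟨n, hn, _, hdU, (h.iterate_iter_neg n d).symm ▸ hd⟩
  have hDLp : Disjoint D {x : Plane | OnePoint.some x ∈ Lp} := by
    obtain ⟨V, hVo, hVc, hDV, -, hVf⟩ := exists_isOpen_isPreconnected_free hD.isCompact
      hD.isPreconnected hDf isOpen_univ (subset_univ D)
    rw [Set.disjoint_left]
    intro x hxD hx
    obtain ⟨n, hn, d, hd, hdV⟩ := hp x hx V hVo (hDV hxD)
    exact hh.iterate_notMem hVo hVc hVf (hDV hd) hn hdV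
  refine ⟨hDLp, ?_, ?_⟩
  · obtain ⟨V, hVo, hVc, hDV, -, hVf⟩ := exists_isOpen_isPreconnected_free hD.isCompact
      hD.isPreconnected hDf isOpen_univ (subset_univ D)
    rw [Set.disjoint_left]
    intro x hxD hx
    obtain ⟨n, hn, y, hy, hyD⟩ := hm x hx V hVo (hDV hxD)
    exact hh.iterate_notMem hVo hVc hVf hy hn (hDV hyD)
  · rw [Set.disjoint_left]
    intro x hxp hxm
    have hxD : x ∉ D := fun hxD => Set.disjoint_left.1 hDLp hxD hxp
    obtain ⟨OU, OV, hOU, hOV, hxOU, hDOV, hO⟩ := SeparatedNhds.of_isCompact_isCompact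
      (isCompact_singleton (x := x)) hD.isCompact (Set.disjoint_singleton_left.2 hxD)
    obtain ⟨V, hVo, hVc, hDV, hVO, hVf⟩ := exists_isOpen_isPreconnected_free hD.isCompact
      hD.isPreconnected hDf hOV hDOV
    obtain ⟨U, hUo, hUc, hxU, hUO, hUf⟩ := exists_isOpen_isPreconnected_free
      (h := h.toHomeomorph) isCompact_singleton isPreconnected_singleton
      (by simpa using h.fixedPointFree x) hOU hxOU
    obtain ⟨n, hn, d, hd, hdU⟩ := hp x hxp U hUo (hxU rfl)
    obtain ⟨m, hm1, y, hy, hyD⟩ := hm x hxm U hUo (hxU rfl)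
    exact hh.no_two_chain hUo hUc hUf hVo hVc hVf (hO.mono hUO hVO) hy (hDV hd) hm1 hn
      (hDV hyD) hdU
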